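/- Let (R,μ) be a non-atomic measure space with 0 < μ(R) < ∞, let B be a Young function, and let 1 ≤ s ≤ r < ∞. Then the following are equivalent: (a) the almost-compact embedding L^r ↪* L^B holds; (b) the almost-compact embedding L^{r,s} ↪* L^B holds; (c) r > 1 and lim_{t→∞} t^r/B(t) = ∞. -/

import Mathlib

open MeasureTheory Filter Set ENNReal

noncomputable section

/-- A Young function: a convex, non-decreasing, left-continuous function
`A : [0,∞] → [0,∞]` with `A(0) = 0`, `A(0+) = 0` and `A(∞) = ∞`. -/
structure YoungFunction where
  toFun : ℝ≥0∞ → ℝ≥0∞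
  map_zero : toFun 0 = 0
  tendsto_zero : Filter.Tendsto toFun (nhdsWithin 0 (Set.Ioi 0)) (nhds 0)
  mono : Monotone toFun
  convex' : ∀ s t c : ℝ≥0∞, c ≤ 1 →
    toFun (c * s + (1 - c) * t) ≤ c * toFun s + (1 - c) * toFun t
  left_continuous : ∀ t : ℝ≥0∞, 0 < t → toFun t = ⨆ s ∈ Set.Iio t, toFun s
  map_top : toFun ⊤ = ⊤

/-- Left-continuous inverse of a non-decreasing function `F : [0,∞] → [0,∞]`:
`F⁻¹(t) = inf {τ ≥ 0 : F(τ) ≥ t}`. -/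
def leftInvE (F : ℝ≥0∞ → ℝ≥0∞) (t : ℝ≥0∞) : ℝ≥0∞ :=
  sInf {τ : ℝ≥0∞ | t ≤ F τ}

/-- `a` is the right-continuous derivative of the Young function `A`:
`a` is non-decreasing, right-continuous, `a(∞) = ∞`, and
`A(t) = ∫₀ᵗ a(s) ds` for all finite `t ≥ 0`. -/
def IsYoungDerivative (A : YoungFunction) (a : ℝ≥0∞ → ℝ≥0∞) : Prop :=
  Monotone a ∧ a ⊤ = ⊤ ∧
    (∀ t : ℝ≥0∞, t ≠ ⊤ → Filter.Tendsto a (nhdsWithin t (Set.Ioi t)) (nhds (a t))) ∧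
    ∀ t : ℝ, 0 ≤ t →
      A.toFun (ENNReal.ofReal t) = ∫⁻ s in Set.Ioc (0:ℝ) t, a (ENNReal.ofReal s)

/-- The Young conjugate `B̃(t) = sup {s·t − B(s) : s ∈ [0,∞]}`. -/
def youngConj (A : YoungFunction) (t : ℝ≥0∞) : ℝ≥0∞ :=
  ⨆ s : ℝ≥0∞, s * t - A.toFun s

variable {R : Type*} [MeasurableSpace R]

/-- The distribution function `f₊(λ) = μ({x : |f(x)| > λ})`. -/
def distFn (μ : Measure R) (f : R → ℝ) (lam : ℝ≥0∞) : ℝ≥0∞ :=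
  μ {x | lam < ENNReal.ofReal |f x|}

/-- The non-increasing rearrangement `f*(t) = inf {λ ≥ 0 : f₊(λ) ≤ t}`. -/
def rearr (μ : Measure R) (f : R → ℝ) (t : ℝ≥0∞) : ℝ≥0∞ :=
  sInf {lam : ℝ≥0∞ | distFn μ f lam ≤ t}

/-- The Lorentz functional `‖f‖_{p,q}` for `p, q ∈ (0,∞]`. -/
def lorentzNorm (μ : Measure R) (p q : ℝ≥0∞) (f : R → ℝ) : ℝ≥0∞ :=
  if q = ⊤ then
    ⨆ t : Set.Ioi (0:ℝ), ENNReal.ofReal t.1 ^ (p⁻¹).toReal * rearr μ f (ENNReal.ofReal t.1)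
  else
    (∫⁻ t in Set.Ioi (0:ℝ),
        (ENNReal.ofReal t ^ (p⁻¹).toReal * rearr μ f (ENNReal.ofReal t)) ^ q.toReal
          / ENNReal.ofReal t) ^ (q⁻¹).toReal

/-- The Luxemburg norm `‖f‖_A = inf {λ > 0 : ∫ A(|f|/λ) dμ ≤ 1}`. -/
def luxNorm (μ : Measure R) (A : YoungFunction) (f : R → ℝ) : ℝ≥0∞ :=
  sInf {lam : ℝ≥0∞ | 0 < lam ∧ ∫⁻ x, A.toFun (ENNReal.ofReal |f x| / lam) ∂μ ≤ 1}

/-- The measure `μ` is non-atomic: every set of positive measure has a subset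
of strictly smaller positive measure. -/
def NonAtomic (μ : Measure R) : Prop :=
  ∀ s : Set R, MeasurableSet s → 0 < μ s →
    ∃ t, t ⊆ s ∧ MeasurableSet t ∧ 0 < μ t ∧ μ t < μ s

/-- The almost-compact embedding `X ↪* Y`, for (quasi)norm functionals `NX`, `NY`:
`X ⊂ Y` and for every sequence of measurable sets `Eₙ` whose characteristic
functions tend to `0` a.e., `sup_{‖f‖_X ≤ 1} ‖f χ_{Eₙ}‖_Y → 0`. -/
def AlmostCompactEmbedding (μ : Measure R) (NX NY : (R → ℝ) → ℝ≥0∞) : Prop :=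
  (∀ f : R → ℝ, Measurable f → NX f < ⊤ → NY f < ⊤) ∧
    ∀ E : ℕ → Set R, (∀ n, MeasurableSet (E n)) →
      (∀ᵐ x ∂μ, Filter.Tendsto (fun n => (E n).indicator (fun _ => (1:ℝ)) x)
        Filter.atTop (nhds 0)) →
      Filter.Tendsto
        (fun n => ⨆ f : {f : R → ℝ // Measurable f ∧ NX f ≤ 1},
          NY ((E n).indicator f.1)) Filter.atTop (nhds 0)

/-- The continuous embedding `X ↪ Y`: there is `C > 0` with `‖f‖_Y ≤ C ‖f‖_X`. -/
def NormEmbedding (μ : Measure R) (NX NY : (R → ℝ) → ℝ≥0∞) : Prop :=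
  ∃ C : ℝ, 0 < C ∧ ∀ f : R → ℝ, Measurable f → NY f ≤ ENNReal.ofReal C * NX f

lemma rearr_antitone (μ : Measure R) (f : R → ℝ) : Antitone (rearr μ f) := by
  intro a b hab
  exact sInf_le_sInf fun l hl => le_trans hl hab

lemma measurable_rearr_ofReal (μ : Measure R) (f : R → ℝ) :
    Measurable fun t : ℝ => rearr μ f (ENNReal.ofReal t) := by
  apply Antitone.measurable
  intro a b hab
  exact rearr_antitone μ f (ENNReal.ofReal_le_ofReal hab)

lemma lorentzNorm_ofReal (μ : Measure R) (f : R → ℝ) {r s : ℝ} (hr : 0 < r) (hs : 0 < s) :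
    lorentzNorm μ (ENNReal.ofReal r) (ENNReal.ofReal s) f =
      (∫⁻ t in Ioi (0 : ℝ), ENNReal.ofReal t ^ (s / r - 1) *
        rearr μ f (ENNReal.ofReal t) ^ s) ^ s⁻¹ := by
  unfold lorentzNorm
  rw [if_neg ENNReal.ofReal_ne_top, ENNReal.toReal_inv, ENNReal.toReal_inv,
    ENNReal.toReal_ofReal hr.le, ENNReal.toReal_ofReal hs.le]
  congr 1
  apply setLIntegral_congr_fun measurableSet_Ioi
  intro t ht
  have h0 : ENNReal.ofReal t ≠ 0 := by simpa using ht
  dsimp only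
  rw [ENNReal.mul_rpow_of_nonneg _ _ hs.le, ← ENNReal.rpow_mul,
    ENNReal.rpow_sub _ _ h0 ENNReal.ofReal_ne_top, ENNReal.rpow_one, div_eq_mul_inv,
    div_eq_mul_inv, inv_mul_eq_div]
  ring

/-- One half of the equimeasurability of a function and its rearrangement, integrated. -/
lemma lintegral_rpow_le_lintegral_rearr_rpow (μ : Measure R) [IsFiniteMeasure μ] {f : R → ℝ}
    (hf : Measurable f) {r : ℝ} (hr : 0 < r)
    (hfin : ∀ t : ℝ, 0 < t → rearr μ f (ENNReal.ofReal t) ≠ ⊤) :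
    ∫⁻ x, ENNReal.ofReal |f x| ^ r ∂μ ≤
      ∫⁻ t in Ioi (0 : ℝ), rearr μ f (ENNReal.ofReal t) ^ r := by
  have h1 : ∫⁻ x, ENNReal.ofReal |f x| ^ r ∂μ = ∫⁻ x, ENNReal.ofReal (|f x| ^ r) ∂μ := by
    simp_rw [ENNReal.ofReal_rpow_of_nonneg (abs_nonneg _) hr.le]
  have h2 : ∫⁻ t in Ioi (0 : ℝ), rearr μ f (ENNReal.ofReal t) ^ r =
      ∫⁻ t in Ioi (0 : ℝ), ENNReal.ofReal ((rearr μ f (ENNReal.ofReal t)).toReal ^ r) := by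
    apply setLIntegral_congr_fun measurableSet_Ioi
    intro t ht
    dsimp only
    rw [← ENNReal.ofReal_rpow_of_nonneg ENNReal.toReal_nonneg hr.le,
      ENNReal.ofReal_toReal (hfin t ht)]
  rw [h1, h2, lintegral_rpow_eq_lintegral_meas_lt_mul μ (f := fun x => |f x|)
      (ae_of_all _ fun _ => abs_nonneg _) hf.abs.aemeasurable hr,
    lintegral_rpow_eq_lintegral_meas_le_mul _ (ae_of_all _ fun _ => ENNReal.toReal_nonneg)
      (measurable_rearr_ofReal μ f).ennreal_toReal.aemeasurable hr]
  gcongr ENNReal.ofReal r * ?_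
  apply setLIntegral_mono' measurableSet_Ioi
  intro l hl
  gcongr
  have hm : μ {a | l < |f a|} = distFn μ f (ENNReal.ofReal l) := by
    unfold distFn
    congr 1
    ext x
    simp only [mem_ofPred_eq]
    rw [ENNReal.ofReal_lt_ofReal_iff_of_nonneg (le_of_lt hl)]
  have hne : μ {a | l < |f a|} ≠ ⊤ := measure_ne_top _ _
  calc μ {a | l < |f a|} = volume (Ioo (0 : ℝ) (μ {a | l < |f a|}).toReal) := by
        rw [Real.volume_Ioo, sub_zero, ENNReal.ofReal_toReal hne]
    _ = (volume.restrict (Ioi 0)) (Ioo (0 : ℝ) (μ {a | l < |f a|}).toReal) := by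
        rw [Measure.restrict_apply measurableSet_Ioo, inter_eq_self_of_subset_left]
        exact Ioo_subset_Ioi_self
    _ ≤ _ := by
        apply measure_mono
        intro t ht
        simp only [mem_ofPred_eq]
        rw [← ENNReal.ofReal_le_iff_le_toReal (hfin t ht.1)]
        apply le_sInf
        intro k hk
        by_contra! hlt
        have h3 : distFn μ f (ENNReal.ofReal l) ≤ distFn μ f k :=
          measure_mono fun x hx => lt_trans hlt hx
        have h4 := (h3.trans hk).trans_lt
          ((ENNReal.ofReal_lt_iff_lt_toReal ht.1.le hne).2 ht.2)
        rw [hm] at h4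
        exact lt_irrefl _ h4

/-- For `s ≤ r` the Lorentz functional `‖·‖_{r,s}` dominates the `L^r` norm. -/
lemma lintegral_rpow_le_lorentzNorm_rpow (μ : Measure R) [IsFiniteMeasure μ] {f : R → ℝ}
    (hf : Measurable f) {r s : ℝ} (hs : 0 < s) (hsr : s ≤ r)
    (hN : lorentzNorm μ (ENNReal.ofReal r) (ENNReal.ofReal s) f < ⊤) :
    ∫⁻ x, ENNReal.ofReal |f x| ^ r ∂μ ≤
      lorentzNorm μ (ENNReal.ofReal r) (ENNReal.ofReal s) f ^ r := by
  have hr : 0 < r := hs.trans_le hsr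
  rw [lorentzNorm_ofReal μ f hr hs] at hN ⊢
  set N := ∫⁻ t in Ioi (0 : ℝ), ENNReal.ofReal t ^ (s / r - 1) *
        rearr μ f (ENNReal.ofReal t) ^ s with hNdef
  have hNt : N ≠ ⊤ := by
    intro h
    rw [h, ENNReal.top_rpow_of_pos (by positivity)] at hN
    exact lt_irrefl _ hN
  have hsr1 : s / r - 1 ≤ 0 := by
    rw [sub_nonpos, div_le_one hr]
    exact hsr
  have hpt : ∀ t : ℝ, 0 < t →
      ENNReal.ofReal t ^ (s / r) * rearr μ f (ENNReal.ofReal t) ^ s ≤ N := by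
    intro t ht
    have h0 : ENNReal.ofReal t ≠ 0 := by simpa using ht
    calc ENNReal.ofReal t ^ (s / r) * rearr μ f (ENNReal.ofReal t) ^ s
        = ∫⁻ _ in Ioc (0 : ℝ) t, ENNReal.ofReal t ^ (s / r - 1) *
            rearr μ f (ENNReal.ofReal t) ^ s := by
          rw [setLIntegral_const, Real.volume_Ioc, sub_zero, mul_right_comm]
          congr 1
          rw [ENNReal.rpow_sub _ _ h0 ENNReal.ofReal_ne_top, ENNReal.rpow_one,
            ENNReal.div_mul_cancel h0 ENNReal.ofReal_ne_top]
      _ ≤ ∫⁻ u in Ioc (0 : ℝ) t, ENNReal.ofReal u ^ (s / r - 1) *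
            rearr μ f (ENNReal.ofReal u) ^ s := by
          apply setLIntegral_mono' measurableSet_Ioc
          intro u hu
          have hut := ENNReal.ofReal_le_ofReal hu.2
          gcongr ?_ * ?_ ^ s
          · rw [← neg_neg (s / r - 1), ENNReal.rpow_neg, ENNReal.rpow_neg _ (-(s / r - 1)),
              ENNReal.inv_le_inv]
            exact ENNReal.rpow_le_rpow hut (by linarith)
          · exact rearr_antitone μ f hut
      _ ≤ N := lintegral_mono_set Ioc_subset_Ioi_self
  have hrs : ∀ t : ℝ, 0 < t →
      rearr μ f (ENNReal.ofReal t) ^ s ≤ N * ENNReal.ofReal t ^ (-(s / r)) := by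
    intro t ht
    have h0 : ENNReal.ofReal t ≠ 0 := by simpa using ht
    rw [ENNReal.rpow_neg, ← div_eq_mul_inv, ENNReal.le_div_iff_mul_le, mul_comm]
    · exact hpt t ht
    · left
      simp [ENNReal.rpow_eq_zero_iff, h0]
    · left
      simp [ENNReal.rpow_eq_top_iff, h0]
  have hfin : ∀ t : ℝ, 0 < t → rearr μ f (ENNReal.ofReal t) ≠ ⊤ := by
    intro t ht htop
    have h0 : ENNReal.ofReal t ≠ 0 := by simpa using ht
    have h := hrs t ht
    rw [htop, ENNReal.top_rpow_of_pos hs, top_le_iff] at h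
    refine ENNReal.mul_ne_top hNt ?_ h
    simp [ENNReal.rpow_eq_top_iff, h0]
  refine (lintegral_rpow_le_lintegral_rearr_rpow μ hf hr hfin).trans ?_
  have hq : 0 ≤ (r - s) / s := div_nonneg (by linarith) hs.le
  calc ∫⁻ t in Ioi (0 : ℝ), rearr μ f (ENNReal.ofReal t) ^ r
      ≤ ∫⁻ t in Ioi (0 : ℝ), N ^ ((r - s) / s) * (ENNReal.ofReal t ^ (s / r - 1) *
          rearr μ f (ENNReal.ofReal t) ^ s) := by
        apply setLIntegral_mono' measurableSet_Ioi
        intro t ht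
        have h := ENNReal.rpow_le_rpow (hrs t ht) hq
        rw [ENNReal.mul_rpow_of_nonneg _ _ hq, ← ENNReal.rpow_mul, ← ENNReal.rpow_mul] at h
        have e1 : -(s / r) * ((r - s) / s) = s / r - 1 := by
          field_simp
          ring
        have e2 : s * ((r - s) / s) = r - s := by field_simp
        rw [e1, e2] at h
        calc rearr μ f (ENNReal.ofReal t) ^ r
            = rearr μ f (ENNReal.ofReal t) ^ (r - s) * rearr μ f (ENNReal.ofReal t) ^ s := by
              rw [← ENNReal.rpow_add_of_nonneg _ _ (by linarith) hs.le, sub_add_cancel]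
          _ ≤ N ^ ((r - s) / s) * ENNReal.ofReal t ^ (s / r - 1) *
                rearr μ f (ENNReal.ofReal t) ^ s := by gcongr
          _ = _ := mul_assoc _ _ _
    _ = N ^ ((r - s) / s) * N := by
        rw [lintegral_const_mul' _ _ (ENNReal.rpow_ne_top_of_nonneg hq hNt)]
    _ = (N ^ s⁻¹) ^ r := by
        nth_rewrite 2 [← ENNReal.rpow_one N]
        rw [← ENNReal.rpow_add_of_nonneg _ _ hq zero_le_one, ← ENNReal.rpow_mul]
        congr 1
        field_simp
        ring

lemma lorentzNorm_indicator_const_le_one (μ : Measure R) {E : Set R} {r s a c : ℝ}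
    (hs : 1 ≤ s) (hsr : s ≤ r) (ha : 0 < a) (hc : 0 ≤ c) (hE : μ E ≤ ENNReal.ofReal a)
    (hca : c * a ^ r⁻¹ ≤ s / r) :
    lorentzNorm μ (ENNReal.ofReal r) (ENNReal.ofReal s) (E.indicator fun _ => c) ≤ 1 := by
  have hs0 : 0 < s := by linarith
  have hr : 0 < r := by linarith
  rw [lorentzNorm_ofReal μ _ hr hs0]
  refine ENNReal.rpow_le_one ?_ (by positivity)
  have hzero : ∀ t, ENNReal.ofReal a ≤ t → rearr μ (E.indicator fun _ => c) t = 0 := by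
    intro t ht
    refine le_antisymm (sInf_le ?_) bot_le
    refine (measure_mono ?_).trans (hE.trans ht)
    intro x hx
    by_contra hxE
    simp [hxE] at hx
  have hle : ∀ t, rearr μ (E.indicator fun _ => c) t ≤ ENNReal.ofReal c := by
    intro t
    refine sInf_le ?_
    have : {x | ENNReal.ofReal c < ENNReal.ofReal |E.indicator (fun _ => c) x|} = ∅ := by
      ext x
      by_cases hx : x ∈ E <;> simp [hx, abs_of_nonneg hc]
    simp [distFn, this]
  have hp : -1 < s / r - 1 := by
    have : 0 < s / r := by positivity
    linarith
  calc ∫⁻ t in Ioi (0 : ℝ), ENNReal.ofReal t ^ (s / r - 1) *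
        rearr μ (E.indicator fun _ => c) (ENNReal.ofReal t) ^ s
      ≤ ∫⁻ t in Ioi (0 : ℝ), (Ioc 0 a).indicator
          (fun t => ENNReal.ofReal (c ^ s * t ^ (s / r - 1))) t := by
        apply setLIntegral_mono' measurableSet_Ioi
        intro t ht
        rcases le_or_gt t a with hta | hta
        · rw [indicator_of_mem (show t ∈ Ioc 0 a from ⟨ht, hta⟩), mul_comm,
            ENNReal.ofReal_mul (by positivity), ENNReal.ofReal_rpow_of_pos ht,
            ← ENNReal.ofReal_rpow_of_nonneg hc hs0.le]
          gcongr
          exact hle _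
        · rw [hzero _ (ENNReal.ofReal_le_ofReal hta.le), ENNReal.zero_rpow_of_pos hs0, mul_zero]
          exact bot_le
    _ ≤ ∫⁻ t in Ioc 0 a, ENNReal.ofReal (c ^ s * t ^ (s / r - 1)) := by
        rw [← lintegral_indicator measurableSet_Ioc]
        exact setLIntegral_le_lintegral _ _
    _ = ENNReal.ofReal (∫ t in Ioc 0 a, c ^ s * t ^ (s / r - 1)) := by
        rw [ofReal_integral_eq_lintegral_ofReal]
        · exact ((intervalIntegrable_iff_integrableOn_Ioc_of_le ha.le).1
            (intervalIntegral.intervalIntegrable_rpow' hp)).const_mul _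
        · filter_upwards [ae_restrict_mem measurableSet_Ioc] with t ht
          have := ht.1
          simp only [Pi.zero_apply]
          positivity
    _ ≤ 1 := by
        rw [← intervalIntegral.integral_of_le ha.le, intervalIntegral.integral_const_mul,
          integral_rpow (Or.inl hp), sub_add_cancel, Real.zero_rpow (by positivity), sub_zero,
          ENNReal.ofReal_le_one]
        have h1 : (c * a ^ r⁻¹) ^ s ≤ s / r := by
          calc (c * a ^ r⁻¹) ^ s ≤ (s / r) ^ s := by gcongr
            _ ≤ (s / r) ^ (1 : ℝ) :=
              Real.rpow_le_rpow_of_exponent_ge (by positivity) ((div_le_one hr).2 hsr) hs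
            _ = s / r := Real.rpow_one _
        rw [Real.mul_rpow hc (by positivity), ← Real.rpow_mul ha.le, inv_mul_eq_div] at h1
        rw [← mul_div_assoc, div_le_one (by positivity)]
        exact h1

lemma NonAtomic.exists_small_subset {μ : Measure R} [IsFiniteMeasure μ] (hna : NonAtomic μ)
    {S : Set R} (hS : MeasurableSet S) (hpos : 0 < μ S) {ε : ℝ≥0∞} (hε : 0 < ε) :
    ∃ T ⊆ S, MeasurableSet T ∧ 0 < μ T ∧ μ T ≤ ε := by
  have hstep : ∀ n : ℕ, ∃ T ⊆ S, MeasurableSet T ∧ 0 < μ T ∧ μ T ≤ μ S * 2⁻¹ ^ n := by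
    intro n
    induction n with
    | zero => exact ⟨S, Subset.rfl, hS, hpos, by simp⟩
    | succ n ih =>
      obtain ⟨T, hTS, hT, hT0, hTle⟩ := ih
      obtain ⟨U, hUT, hU, hU0, hUlt⟩ := hna T hT hT0
      have hsum : μ U + μ (T \ U) = μ T := by
        rw [← measure_inter_add_sdiff T hU, inter_eq_self_of_subset_right hUT]
      have hhalf : μ T * 2⁻¹ ≤ μ S * 2⁻¹ ^ (n + 1) := by
        rw [pow_succ, ← mul_assoc]
        gcongr
      rcases le_total (μ U) (μ (T \ U)) with h | h
      · refine ⟨U, hUT.trans hTS, hU, hU0, le_trans ?_ hhalf⟩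
        rw [← div_eq_mul_inv, ENNReal.le_div_iff_mul_le (by simp) (by simp), mul_two, ← hsum]
        gcongr
      · refine ⟨T \ U, sdiff_subset.trans hTS, hT.diff hU, ?_, le_trans ?_ hhalf⟩
        · rw [pos_iff_ne_zero]
          intro h0
          rw [h0, add_zero] at hsum
          exact hUlt.ne hsum
        · rw [← div_eq_mul_inv, ENNReal.le_div_iff_mul_le (by simp) (by simp), mul_two, ← hsum]
          gcongr
  have hlim : Tendsto (fun n : ℕ => μ S * (2⁻¹ : ℝ≥0∞) ^ n) atTop (nhds 0) := by
    have := ENNReal.Tendsto.const_mul (a := μ S)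
      (ENNReal.tendsto_pow_atTop_nhds_zero_of_lt_one (r := 2⁻¹) (by simp))
      (Or.inr (measure_ne_top μ S))
    simpa using this
  obtain ⟨n, hn⟩ := (hlim.eventually_lt_const hε).exists
  obtain ⟨T, hTS, hT, hT0, hTle⟩ := hstep n
  exact ⟨T, hTS, hT, hT0, hTle.trans hn.le⟩

/-- A finite non-atomic measure takes a value in `(a/2, a]` for every `0 < a ≤ μ(R)`. -/
lemma NonAtomic.exists_half_lt_measure_le {μ : Measure R} [IsFiniteMeasure μ] (hna : NonAtomic μ)
    {a : ℝ≥0∞} (ha : 0 < a) (hau : a ≤ μ univ) :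
    ∃ E, MeasurableSet E ∧ a / 2 < μ E ∧ μ E ≤ a := by
  by_contra! hcon
  have hat : a ≠ ⊤ := ne_top_of_le_ne_top (measure_ne_top μ univ) hau
  have hgap : ∀ E, MeasurableSet E → μ E ≤ a → μ E ≤ a / 2 := by
    intro E hE hEa
    by_contra! h
    exact absurd hEa (not_le.2 (hcon E hE h))
  have hunion : ∀ E F, MeasurableSet E → MeasurableSet F → μ E ≤ a / 2 → μ F ≤ a / 2 →
      μ (E ∪ F) ≤ a / 2 := by
    intro E F hE hF h1 h2
    refine hgap _ (hE.union hF) ((measure_union_le E F).trans ?_)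
    calc μ E + μ F ≤ a / 2 + a / 2 := by gcongr
      _ = a := ENNReal.add_halves a
  set S : Set ℝ≥0∞ := {m | ∃ E, MeasurableSet E ∧ μ E ≤ a / 2 ∧ m = μ E} with hSdef
  have hSne : S.Nonempty := ⟨0, ∅, MeasurableSet.empty, by simp, by simp⟩
  obtain ⟨u, -, hulim, huS⟩ := exists_seq_tendsto_sSup hSne (OrderTop.bddAbove S)
  choose E hEm hEle hEu using huS
  have hacc : ∀ n, MeasurableSet (accumulate E n) ∧ μ (accumulate E n) ≤ a / 2 := by
    intro n
    induction n with
    | zero => simpa [accumulate_zero_nat] using ⟨hEm 0, hEle 0⟩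
    | succ n ih =>
      rw [accumulate_succ]
      exact ⟨ih.1.union (hEm _), hunion _ _ ih.1 (hEm _) ih.2 (hEle _)⟩
  set V := ⋃ n, E n with hV
  have hVm : MeasurableSet V := MeasurableSet.iUnion hEm
  have hVle : μ V ≤ a / 2 := by
    refine le_of_tendsto' (tendsto_measure_iUnion_accumulate (μ := μ) (f := E)) ?_
    exact fun n => (hacc n).2
  have hsup : sSup S ≤ μ V := by
    refine le_of_tendsto' hulim fun n => ?_
    rw [hEu]
    exact measure_mono (subset_iUnion E n)
  have hlt : a / 2 < a := ENNReal.half_lt_self ha.ne' hat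
  have hcompl : 0 < μ Vᶜ := by
    rw [measure_compl hVm (measure_ne_top _ _)]
    exact tsub_pos_of_lt (hVle.trans_lt (hlt.trans_le hau))
  obtain ⟨T, hTV, hT, hT0, hTle⟩ := hna.exists_small_subset hVm.compl hcompl
    (ENNReal.half_pos ha.ne')
  have hdisj : Disjoint V T := (disjoint_compl_right (a := V)).mono_right hTV
  have hmem : μ (V ∪ T) ∈ S := ⟨_, hVm.union hT, hunion _ _ hVm hT hVle hTle, rfl⟩
  have h := (le_sSup hmem).trans hsup
  rw [measure_union hdisj hT] at h
  exact absurd h (not_le.2 (ENNReal.lt_add_right (measure_ne_top _ _) hT0.ne'))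

lemma YoungFunction.apply_mul_le (B : YoungFunction) {c t : ℝ≥0∞} (hc : c ≤ 1) :
    B.toFun (c * t) ≤ c * B.toFun t := by
  simpa [B.map_zero] using B.convex' t 0 c hc

lemma YoungFunction.exists_pos (B : YoungFunction) :
    ∃ t : ℝ, 0 < t ∧ 0 < B.toFun (ENNReal.ofReal t) := by
  have h : (0 : ℝ≥0∞) < ⨆ s ∈ Iio (⊤ : ℝ≥0∞), B.toFun s := by
    rw [← B.left_continuous ⊤ (by simp), B.map_top]
    simp
  simp only [lt_iSup_iff] at h
  obtain ⟨s, hs, hBs⟩ := h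
  have hs0 : s ≠ 0 := by
    rintro rfl
    rw [B.map_zero] at hBs
    exact lt_irrefl _ hBs
  refine ⟨s.toReal, ENNReal.toReal_pos hs0 (ne_of_lt hs), ?_⟩
  rwa [ENNReal.ofReal_toReal (ne_of_lt hs)]

/-- A Young function grows at least linearly. -/
lemma YoungFunction.not_tendsto_div_self (B : YoungFunction) :
    ¬ Tendsto (fun t : ℝ => ENNReal.ofReal t / B.toFun (ENNReal.ofReal t)) atTop (nhds ⊤) := by
  intro h
  obtain ⟨t₀, ht₀, hB⟩ := B.exists_pos
  have hlt : ENNReal.ofReal t₀ / B.toFun (ENNReal.ofReal t₀) < ⊤ :=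
    ENNReal.div_lt_top ENNReal.ofReal_ne_top hB.ne'
  obtain ⟨t, h1, h2⟩ := ((h.eventually_const_lt hlt).and (eventually_ge_atTop t₀)).exists
  have ht : 0 < t := ht₀.trans_le h2
  refine absurd h1 (not_lt.2 ?_)
  have hle := B.apply_mul_le (c := ENNReal.ofReal (t₀ / t)) (t := ENNReal.ofReal t)
    (by rw [ENNReal.ofReal_le_one, div_le_one ht]; exact h2)
  rw [← ENNReal.ofReal_mul (by positivity), div_mul_cancel₀ _ ht.ne',
    ENNReal.ofReal_div_of_pos ht] at hle
  have ht0 : ENNReal.ofReal t ≠ 0 := by simpa using ht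
  have hBt : B.toFun (ENNReal.ofReal t) ≠ 0 :=
    (hB.trans_le (B.mono (ENNReal.ofReal_le_ofReal h2))).ne'
  rcases eq_or_ne (B.toFun (ENNReal.ofReal t)) ⊤ with htop | htop
  · simp [htop]
  have hB0 : B.toFun (ENNReal.ofReal t₀) ≠ ⊤ :=
    ne_top_of_le_ne_top htop (B.mono (ENNReal.ofReal_le_ofReal h2))
  rw [ENNReal.div_le_iff_le_mul (Or.inl hBt) (Or.inl htop), ← ENNReal.mul_div_right_comm,
    ENNReal.le_div_iff_mul_le (Or.inl hB.ne') (Or.inl hB0)]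
  calc ENNReal.ofReal t * B.toFun (ENNReal.ofReal t₀)
      ≤ ENNReal.ofReal t * (ENNReal.ofReal t₀ / ENNReal.ofReal t * B.toFun (ENNReal.ofReal t)) := by
        gcongr
    _ = ENNReal.ofReal t₀ * B.toFun (ENNReal.ofReal t) := by
        rw [← mul_assoc, ENNReal.mul_div_cancel ht0 ENNReal.ofReal_ne_top]

lemma luxNorm_le {μ : Measure R} {B : YoungFunction} {f : R → ℝ} {l : ℝ≥0∞} (hl : 0 < l)
    (h : ∫⁻ x, B.toFun (ENNReal.ofReal |f x| / l) ∂μ ≤ 1) : luxNorm μ B f ≤ l :=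
  sInf_le ⟨hl, h⟩

lemma luxNorm_lt_top {μ : Measure R} {B : YoungFunction} {f : R → ℝ}
    (h : ∫⁻ x, B.toFun (ENNReal.ofReal |f x|) ∂μ < ⊤) : luxNorm μ B f < ⊤ := by
  set J := ∫⁻ x, B.toFun (ENNReal.ofReal |f x|) ∂μ
  have h1 : 1 + J ≠ ⊤ := by simp [h.ne]
  have h0 : 1 + J ≠ 0 := by simp
  refine lt_of_le_of_lt (luxNorm_le (l := 1 + J) (pos_iff_ne_zero.2 h0) ?_) h1.lt_top
  calc ∫⁻ x, B.toFun (ENNReal.ofReal |f x| / (1 + J)) ∂μ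
      ≤ ∫⁻ x, (1 + J)⁻¹ * B.toFun (ENNReal.ofReal |f x|) ∂μ := by
        apply lintegral_mono
        intro x
        dsimp only
        rw [div_eq_mul_inv, mul_comm]
        exact B.apply_mul_le (by simp)
    _ = (1 + J)⁻¹ * J := lintegral_const_mul' _ _ (ENNReal.inv_ne_top.2 h0)
    _ ≤ (1 + J)⁻¹ * (1 + J) := by
        gcongr
        exact le_add_self
    _ = 1 := ENNReal.inv_mul_cancel h0 h1

lemma YoungFunction.exists_mul_le_rpow {B : YoungFunction} {r : ℝ}
    (h : Tendsto (fun t : ℝ => ENNReal.ofReal t ^ r / B.toFun (ENNReal.ofReal t))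
      atTop (nhds ⊤)) {K : ℝ≥0∞} (hK0 : K ≠ 0) (hK : K ≠ ⊤) :
    ∃ C : ℝ≥0∞, C ≠ ⊤ ∧ ∀ t : ℝ, B.toFun (ENNReal.ofReal t) ≤
      C + K⁻¹ * ENNReal.ofReal t ^ r := by
  obtain ⟨T, hT⟩ := eventually_atTop.1 (h.eventually_const_lt hK.lt_top)
  have hle : ∀ t : ℝ, T ≤ t → B.toFun (ENNReal.ofReal t) ≤ K⁻¹ * ENNReal.ofReal t ^ r := by
    intro t ht
    have h1 := ENNReal.mul_le_of_le_div (hT t ht).le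
    rw [← ENNReal.div_eq_inv_mul, ENNReal.le_div_iff_mul_le (Or.inl hK0) (Or.inl hK), mul_comm]
    exact h1
  have hTfin : B.toFun (ENNReal.ofReal (max T 1)) ≠ ⊤ := by
    refine ne_top_of_le_ne_top ?_ (hle _ (le_max_left _ _))
    refine ENNReal.mul_ne_top (ENNReal.inv_ne_top.2 hK0) ?_
    have h1 : (0 : ℝ) < max T 1 := by positivity
    rw [ENNReal.ofReal_rpow_of_pos h1]
    exact ENNReal.ofReal_ne_top
  refine ⟨_, hTfin, fun t => ?_⟩
  rcases le_total T t with ht | ht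
  · exact (hle t ht).trans le_add_self
  · exact (B.mono (ENNReal.ofReal_le_ofReal (ht.trans (le_max_left _ _)))).trans le_self_add

lemma almostCompactEmbedding_of_tendsto (μ : Measure R) [IsFiniteMeasure μ] (B : YoungFunction)
    {r s : ℝ} (hs : 1 ≤ s) (hsr : s ≤ r)
    (h : Tendsto (fun t : ℝ => ENNReal.ofReal t ^ r / B.toFun (ENNReal.ofReal t))
      atTop (nhds ⊤)) :
    AlmostCompactEmbedding μ (lorentzNorm μ (ENNReal.ofReal r) (ENNReal.ofReal s))
      (luxNorm μ B) := by
  have hs0 : 0 < s := by linarith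
  have hr : 0 < r := by linarith
  refine ⟨fun f hf hN => ?_, fun E hE hlim => ?_⟩
  · obtain ⟨C, hC, hB⟩ := B.exists_mul_le_rpow h one_ne_zero ENNReal.one_ne_top
    apply luxNorm_lt_top
    calc ∫⁻ x, B.toFun (ENNReal.ofReal |f x|) ∂μ
        ≤ ∫⁻ x, (C + 1⁻¹ * ENNReal.ofReal |f x| ^ r) ∂μ := lintegral_mono fun x => hB _
      _ = C * μ univ + ∫⁻ x, ENNReal.ofReal |f x| ^ r ∂μ := by
          rw [lintegral_add_left measurable_const, lintegral_const]
          simp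
      _ < ⊤ := by
          refine ENNReal.add_lt_top.2 ⟨ENNReal.mul_lt_top hC.lt_top (measure_lt_top μ _), ?_⟩
          exact (lintegral_rpow_le_lorentzNorm_rpow μ hf hs0 hsr hN).trans_lt
            (ENNReal.rpow_lt_top_of_nonneg hr.le hN.ne)
  · have hμE : Tendsto (fun n => μ (E n)) atTop (nhds 0) := by
      have h1 : Tendsto (fun n => ∫⁻ x, ENNReal.ofReal ((E n).indicator (fun _ => (1 : ℝ)) x) ∂μ)
          atTop (nhds (∫⁻ _, 0 ∂μ)) := by
        refine tendsto_lintegral_of_dominated_convergence (fun _ => 1) ?_ ?_ ?_ ?_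
        · exact fun n => (measurable_const.indicator (hE n)).ennreal_ofReal
        · refine fun n => ae_of_all _ fun x => ?_
          by_cases hx : x ∈ E n <;> simp [hx]
        · simp
        · filter_upwards [hlim] with x hx
          simpa using ENNReal.tendsto_ofReal hx
      rw [lintegral_zero] at h1
      refine h1.congr fun n => ?_
      rw [← lintegral_indicator_one (hE n)]
      congr 1
      ext x
      by_cases hx : x ∈ E n <;> simp [hx]
    rw [ENNReal.tendsto_nhds_zero]
    intro ε hε
    wlog hεt : ε ≠ ⊤ generalizing ε
    · rw [not_not.1 hεt]
      exact Eventually.of_forall fun n => le_top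
    have hεr0 : ε ^ r ≠ 0 := by simp [ENNReal.rpow_eq_zero_iff, hε.ne', hεt]
    have hεrt : ε ^ r ≠ ⊤ := ENNReal.rpow_ne_top_of_nonneg hr.le hεt
    obtain ⟨C, hC, hB⟩ := B.exists_mul_le_rpow h (K := 2 * (ε ^ r)⁻¹)
      (by simp [hεrt]) (ENNReal.mul_ne_top (by simp) (ENNReal.inv_ne_top.2 hεr0))
    have hCE : Tendsto (fun n => C * μ (E n)) atTop (nhds 0) := by
      simpa using ENNReal.Tendsto.const_mul hμE (Or.inr hC)
    filter_upwards [hCE.eventually_le_const (show (0 : ℝ≥0∞) < 2⁻¹ by simp)] with n hn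
    refine iSup_le fun ⟨f, hf, hN⟩ => luxNorm_le hε ?_
    have hfr := (lintegral_rpow_le_lorentzNorm_rpow μ hf hs0 hsr
      (hN.trans_lt ENNReal.one_lt_top)).trans (ENNReal.rpow_le_one hN hr.le)
    have hpt : ∀ x, B.toFun (ENNReal.ofReal |(E n).indicator f x| / ε) ≤
        (E n).indicator (fun _ => C) x + 2⁻¹ * ENNReal.ofReal |f x| ^ r := by
      intro x
      by_cases hx : x ∈ E n
      · have hxe : ENNReal.ofReal |f x| / ε = ENNReal.ofReal (|f x| / ε.toReal) := by
          rw [ENNReal.ofReal_div_of_pos (ENNReal.toReal_pos hε.ne' hεt),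
            ENNReal.ofReal_toReal hεt]
        rw [indicator_of_mem hx, indicator_of_mem hx, hxe]
        refine (hB _).trans (le_of_eq ?_)
        rw [← hxe, ENNReal.div_rpow_of_nonneg _ _ hr.le,
          ENNReal.mul_inv (by simp) (by simp), inv_inv, mul_assoc,
          ENNReal.mul_div_cancel hεr0 hεrt]
      · simp [hx, B.map_zero]
    calc ∫⁻ x, B.toFun (ENNReal.ofReal |(E n).indicator f x| / ε) ∂μ
        ≤ ∫⁻ x, ((E n).indicator (fun _ => C) x + 2⁻¹ * ENNReal.ofReal |f x| ^ r) ∂μ :=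
          lintegral_mono hpt
      _ = C * μ (E n) + 2⁻¹ * ∫⁻ x, ENNReal.ofReal |f x| ^ r ∂μ := by
          rw [lintegral_add_left (measurable_const.indicator (hE n)),
            lintegral_indicator_const (hE n), lintegral_const_mul' _ _ (by simp)]
      _ ≤ 2⁻¹ + 2⁻¹ * 1 := by gcongr
      _ = 1 := by rw [mul_one, ENNReal.inv_two_add_inv_two]

lemma tendsto_of_almostCompactEmbedding (μ : Measure R) [IsFiniteMeasure μ] (hna : NonAtomic μ)
    (hpos : 0 < μ univ) (B : YoungFunction) {r s : ℝ} (hs : 1 ≤ s) (hsr : s ≤ r)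
    (h : AlmostCompactEmbedding μ (lorentzNorm μ (ENNReal.ofReal r) (ENNReal.ofReal s))
      (luxNorm μ B)) :
    Tendsto (fun t : ℝ => ENNReal.ofReal t ^ r / B.toFun (ENNReal.ofReal t))
      atTop (nhds ⊤) := by
  have hs0 : 0 < s := by linarith
  have hr : 0 < r := by linarith
  rw [ENNReal.tendsto_nhds_top_iff_nnreal]
  intro K
  by_contra hK
  have hfreq : ∃ᶠ t : ℝ in atTop,
      ENNReal.ofReal t ^ r / B.toFun (ENNReal.ofReal t) ≤ K :=
    (not_eventually.1 hK).mono fun t ht => not_lt.1 ht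
  set M : ℝ := 2 * K + 1 with hMdef
  have hM : 0 < M := by positivity
  have hlim : Tendsto (fun t : ℝ => ENNReal.ofReal (M / t ^ r)) atTop (nhds 0) := by
    have h1 : Tendsto (fun t : ℝ => M / t ^ r) atTop (nhds 0) :=
      (tendsto_rpow_atTop hr).const_div_atTop M
    simpa using ENNReal.tendsto_ofReal h1
  have hex : ∀ n : ℕ, ∃ t : ℝ, 0 < t ∧ ENNReal.ofReal (M / t ^ r) ≤ 2⁻¹ ^ n ∧
      ENNReal.ofReal (M / t ^ r) ≤ μ univ ∧
      ENNReal.ofReal t ^ r / B.toFun (ENNReal.ofReal t) ≤ K := by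
    intro n
    have h2 : (0 : ℝ≥0∞) < 2⁻¹ ^ n := ENNReal.pow_pos (by simp) n
    obtain ⟨t, ht, h3, h4, h5⟩ := (hfreq.and_eventually ((eventually_gt_atTop 0).and
      ((hlim.eventually_le_const h2).and (hlim.eventually_le_const hpos)))).exists
    exact ⟨t, h3, h4, h5, ht⟩
  choose t ht0 ht2 htu htK using hex
  have hapos : ∀ n, 0 < M / t n ^ r := fun n => div_pos hM (Real.rpow_pos_of_pos (ht0 n) r)
  choose E hEm hElow hEup using fun n =>
    hna.exists_half_lt_measure_le (ENNReal.ofReal_pos.2 (hapos n)) (htu n)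
  have hsum : ∑' n, μ (E n) ≠ ⊤ := by
    refine ne_top_of_le_ne_top ?_ (ENNReal.tsum_le_tsum fun n => (hEup n).trans (ht2 n))
    rw [ENNReal.tsum_geometric]
    simp
  have hae : ∀ᵐ x ∂μ, Tendsto (fun n => (E n).indicator (fun _ => (1 : ℝ)) x) atTop (nhds 0) := by
    filter_upwards [ae_eventually_notMem hsum] with x hx
    refine tendsto_const_nhds.congr' ?_
    filter_upwards [hx] with n hn
    simp [hn]
  set l : ℝ := s / r * M ^ (-r⁻¹) with hl
  have hl0 : 0 < l := by positivity
  obtain ⟨n, hn⟩ := ((h.2 E hEm hae).eventually_lt_const (ENNReal.ofReal_pos.2 hl0)).exists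
  have hnorm : lorentzNorm μ (ENNReal.ofReal r) (ENNReal.ofReal s)
      ((E n).indicator fun _ => l * t n) ≤ 1 := by
    refine lorentzNorm_indicator_const_le_one μ hs hsr (hapos n)
      (mul_pos hl0 (ht0 n)).le (hEup n) (le_of_eq ?_)
    have htn := ht0 n
    rw [Real.div_rpow hM.le (by positivity), ← Real.rpow_mul htn.le, mul_inv_cancel₀ hr.ne',
      Real.rpow_one, hl, Real.rpow_neg hM.le]
    field_simp
  have hlt : luxNorm μ B ((E n).indicator fun _ => l * t n) < ENNReal.ofReal l := by
    refine lt_of_le_of_lt ?_ hn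
    refine le_trans (le_of_eq ?_) (le_iSup (fun f : {f : R → ℝ // Measurable f ∧
      lorentzNorm μ (ENNReal.ofReal r) (ENNReal.ofReal s) f ≤ 1} =>
        luxNorm μ B ((E n).indicator f.1))
      ⟨(E n).indicator fun _ => l * t n, measurable_const.indicator (hEm n), hnorm⟩)
    simp only [indicator_indicator, inter_self]
  obtain ⟨k, ⟨hk0, hk1⟩, hkl⟩ := sInf_lt_iff.1 hlt
  have hBE : B.toFun (ENNReal.ofReal (t n)) * μ (E n) ≤ 1 := by
    refine le_trans ?_ hk1
    rw [← lintegral_indicator_const (hEm n)]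
    apply lintegral_mono
    intro x
    by_cases hx : x ∈ E n
    · dsimp only
      rw [indicator_of_mem hx, indicator_of_mem hx, abs_of_pos (mul_pos hl0 (ht0 n))]
      apply B.mono
      rw [ENNReal.le_div_iff_mul_le (Or.inl hk0.ne') (Or.inl hkl.ne_top), mul_comm,
        ENNReal.ofReal_mul hl0.le]
      gcongr
    · simp [hx]
  have hEpos : μ (E n) ≠ 0 := (bot_le.trans_lt (hElow n)).ne'
  have hBt : B.toFun (ENNReal.ofReal (t n)) ≠ ⊤ := by
    intro htop
    rw [htop, ENNReal.top_mul hEpos] at hBE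
    exact absurd hBE (by simp)
  have htr0 : ENNReal.ofReal (t n) ^ r = ENNReal.ofReal (t n ^ r) :=
    ENNReal.ofReal_rpow_of_pos (ht0 n)
  have htpos : 0 < t n ^ r := Real.rpow_pos_of_pos (ht0 n) r
  have hBK : ENNReal.ofReal (t n ^ r) ≤ K * B.toFun (ENNReal.ofReal (t n)) := by
    have h1 := htK n
    rw [htr0] at h1
    rcases eq_or_ne (B.toFun (ENNReal.ofReal (t n))) 0 with h0 | h0
    · rw [h0, ENNReal.div_zero (ENNReal.ofReal_pos.2 htpos).ne'] at h1
      exact absurd h1 (by simp)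
    · exact (ENNReal.div_le_iff_le_mul (Or.inl h0) (Or.inl hBt)).1 h1
  have hfinal : ENNReal.ofReal (M / 2) ≤ ENNReal.ofReal K := by
    calc ENNReal.ofReal (M / 2)
        = ENNReal.ofReal (t n ^ r) * (ENNReal.ofReal (M / t n ^ r) / 2) := by
          rw [← ENNReal.ofReal_ofNat 2, ← ENNReal.ofReal_div_of_pos (by norm_num),
            ← ENNReal.ofReal_mul htpos.le]
          congr 1
          field_simp
      _ ≤ (K * B.toFun (ENNReal.ofReal (t n))) * μ (E n) := by
          gcongr
          exact (hElow n).le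
      _ = K * (B.toFun (ENNReal.ofReal (t n)) * μ (E n)) := mul_assoc _ _ _
      _ ≤ K * 1 := by gcongr
      _ = ENNReal.ofReal K := by simp
  rw [ENNReal.ofReal_le_ofReal_iff K.coe_nonneg] at hfinal
  linarith

lemma almostCompactEmbedding_lorentz_orlicz_iff (μ : Measure R) [IsFiniteMeasure μ]
    (hna : NonAtomic μ) (hpos : 0 < μ univ) (B : YoungFunction) {r s : ℝ} (hs : 1 ≤ s)
    (hsr : s ≤ r) :
    AlmostCompactEmbedding μ (lorentzNorm μ (ENNReal.ofReal r) (ENNReal.ofReal s))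
        (luxNorm μ B) ↔
      (1 < r ∧ Tendsto (fun t : ℝ => ENNReal.ofReal t ^ r / B.toFun (ENNReal.ofReal t))
        atTop (nhds ⊤)) := by
  refine ⟨fun h => ?_, fun h => almostCompactEmbedding_of_tendsto μ B hs hsr h.2⟩
  have hlim := tendsto_of_almostCompactEmbedding μ hna hpos B hs hsr h
  refine ⟨lt_of_le_of_ne (hs.trans hsr) ?_, hlim⟩
  rintro rfl
  simp only [ENNReal.rpow_one] at hlim
  exact B.not_tendsto_div_self hlim

/-- On a non-atomic finite measure space of positive measure,
for a Young function `B` and `1 ≤ s ≤ r < ∞`, the following are equivalent: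
(a) `L^r ↪* L^B`; (b) `L^{r,s} ↪* L^B`; (c) `r > 1` and `lim_{t→∞} t^r/B(t) = ∞`. -/
theorem lorentz_orlicz_almost_compact_nonconvex
    {R : Type*} [MeasurableSpace R] (μ : Measure R)
    (hna : NonAtomic μ) (hpos : 0 < μ Set.univ) (hfin : μ Set.univ < ⊤)
    (B : YoungFunction) (r s : ℝ) (hs : 1 ≤ s) (hsr : s ≤ r) :
    (AlmostCompactEmbedding μ
        (lorentzNorm μ (ENNReal.ofReal r) (ENNReal.ofReal r)) (luxNorm μ B) ↔
      AlmostCompactEmbedding μ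
        (lorentzNorm μ (ENNReal.ofReal r) (ENNReal.ofReal s)) (luxNorm μ B)) ∧
    (AlmostCompactEmbedding μ
        (lorentzNorm μ (ENNReal.ofReal r) (ENNReal.ofReal s)) (luxNorm μ B) ↔
      (1 < r ∧ Filter.Tendsto
        (fun t : ℝ => ENNReal.ofReal t ^ r / B.toFun (ENNReal.ofReal t))
        Filter.atTop (nhds ⊤))) := by
  have : IsFiniteMeasure μ := ⟨hfin⟩
  have h := almostCompactEmbedding_lorentz_orlicz_iff μ hna hpos B hs hsr
  exact ⟨(almostCompactEmbedding_lorentz_orlicz_iff μ hna hpos B (hs.trans hsr) le_rfl).trans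
    h.symm, h⟩
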